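/- Let A be a unital C*-algebra with the Dixmier property whose tracial state space T(A) is non-empty. Then there exists a unique proper closed two-sided ideal J of A with the following property: for every proper closed two-sided ideal K of A, the quotient A/K has the singleton Dixmier property if and only if K ⊇ J. -/

import Mathlib

open scoped ComplexOrder

noncomputable section

universe u

variable {A : Type u} [CStarAlgebra A]

/-- A tracial state on a C*-algebra: a positive linear functional of norm 1 with the trace
property. -/
def IsTracialState (τ : A →L[ℂ] ℂ) : Prop :=
  ‖τ‖ = 1 ∧ (∀ a : A, 0 ≤ τ (star a * a)) ∧ ∀ a b : A, τ (a * b) = τ (b * a)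

/-- A closed two-sided ideal of a C*-algebra, regarded as a `ℂ`-submodule. -/
def IsClosedTwoSidedIdeal (I : Submodule ℂ A) : Prop :=
  IsClosed (I : Set A) ∧ ∀ a b : A, b ∈ I → a * b ∈ I ∧ b * a ∈ I

/-- The Dixmier set of `a`: the norm-closed convex hull of the unitary conjugates of `a`. -/
def dixmierSet {B : Type*} [CStarAlgebra B] (a : B) : Set B :=
  closure (convexHull ℝ {b : B | ∃ u : unitary B, b = (u : B) * a * star (u : B)})

/-- The Dixmier property. -/
def DixmierProperty (B : Type*) [CStarAlgebra B] : Prop :=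
  ∀ a : B, (dixmierSet a ∩ Set.center B).Nonempty

/-- The singleton Dixmier property. -/
def SingletonDixmierProperty (B : Type*) [CStarAlgebra B] : Prop :=
  ∀ a : B, ∃ z : B, dixmierSet a ∩ Set.center B = {z}

section DixmierSet

variable {B : Type*} [CStarAlgebra B]

/-- Conjugation by a unitary, as a real-linear map. -/
def unitaryConj (u : unitary B) : B →ₗ[ℝ] B :=
  LinearMap.mulLeftRight ℝ ((u : B), star (u : B))

@[simp]
lemma unitaryConj_apply (u : unitary B) (x : B) :
    unitaryConj u x = (u : B) * x * star (u : B) := by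
  simp [unitaryConj]

lemma continuous_unitaryConj (u : unitary B) : Continuous (unitaryConj u) := by
  have : ⇑(unitaryConj u) = fun x => (u : B) * x * star (u : B) := by ext; simp
  rw [this]
  fun_prop

lemma isClosed_dixmierSet (a : B) : IsClosed (dixmierSet a) := isClosed_closure

lemma convex_dixmierSet (a : B) : Convex ℝ (dixmierSet a) := (convex_convexHull ℝ _).closure

lemma unitary_conj_mem_dixmierSet_self (a : B) (u : unitary B) :
    (u : B) * a * star (u : B) ∈ dixmierSet a :=
  subset_closure (subset_convexHull ℝ _ ⟨u, rfl⟩)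

lemma self_mem_dixmierSet (a : B) : a ∈ dixmierSet a := by
  simpa using unitary_conj_mem_dixmierSet_self a 1

lemma dixmierSet_subset {a : B} {C : Set B} (hC : IsClosed C) (hconv : Convex ℝ C)
    (h : ∀ u : unitary B, (u : B) * a * star (u : B) ∈ C) : dixmierSet a ⊆ C :=
  closure_minimal (convexHull_min (by rintro _ ⟨u, rfl⟩; exact h u) hconv) hC

lemma unitary_conj_mem_dixmierSet {a x : B} (hx : x ∈ dixmierSet a) (u : unitary B) :
    (u : B) * x * star (u : B) ∈ dixmierSet a := by
  have : dixmierSet a ⊆ unitaryConj u ⁻¹' dixmierSet a := by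
    refine dixmierSet_subset ((isClosed_dixmierSet a).preimage (continuous_unitaryConj u))
      ((convex_dixmierSet a).linear_preimage _) fun v => ?_
    have := unitary_conj_mem_dixmierSet_self a (u * v)
    simpa [mul_assoc] using this
  simpa using this hx

lemma dixmierSet_subset_of_mem {a b : B} (hb : b ∈ dixmierSet a) : dixmierSet b ⊆ dixmierSet a :=
  dixmierSet_subset (isClosed_dixmierSet a) (convex_dixmierSet a)
    (unitary_conj_mem_dixmierSet hb)

lemma dixmierSet_unitary_conj_subset (a : B) (u : unitary B) :
    dixmierSet ((u : B) * a * star (u : B)) ⊆ dixmierSet a :=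
  dixmierSet_subset_of_mem (unitary_conj_mem_dixmierSet_self a u)

lemma unitary_conj_of_mem_center {z : B} (hz : z ∈ Set.center B) (u : unitary B) :
    (u : B) * z * star (u : B) = z := by
  rw [← (Set.mem_center_iff.mp hz).comm, mul_assoc, Unitary.mul_star_self_of_mem u.2, mul_one]

lemma dixmierSet_of_mem_center {z : B} (hz : z ∈ Set.center B) : dixmierSet z = {z} := by
  refine Set.Subset.antisymm (dixmierSet_subset isClosed_singleton (convex_singleton z) ?_) ?_
  · simp [unitary_conj_of_mem_center hz]
  · simpa using self_mem_dixmierSet z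

lemma norm_unitary_conj_le (u : unitary B) (a : B) : ‖(u : B) * a * star (u : B)‖ ≤ ‖a‖ := by
  rw [← Unitary.coe_star, CStarRing.norm_mul_coe_unitary, CStarRing.norm_coe_unitary_mul]

lemma dixmierSet_subset_closedBall {a z : B} (hz : z ∈ Set.center B) {r : ℝ} (h : ‖a - z‖ ≤ r) :
    dixmierSet a ⊆ Metric.closedBall z r := by
  refine dixmierSet_subset Metric.isClosed_closedBall (convex_closedBall z r) fun u => ?_
  rw [mem_closedBall_iff_norm]
  calc _ = ‖(u : B) * (a - z) * star (u : B)‖ := by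
        rw [mul_sub, sub_mul, unitary_conj_of_mem_center hz]
    _ ≤ r := (norm_unitary_conj_le u _).trans h

lemma mul_mem_dixmierSet {a c z : B} (hc : c ∈ Set.center B) (hz : z ∈ dixmierSet a) :
    c * z ∈ dixmierSet (c * a) := by
  have : dixmierSet a ⊆ LinearMap.mulLeft ℝ c ⁻¹' dixmierSet (c * a) := by
    refine dixmierSet_subset ((isClosed_dixmierSet _).preimage (continuous_const_mul c))
      ((convex_dixmierSet _).linear_preimage _) fun u => ?_
    have := unitary_conj_mem_dixmierSet_self (c * a) u
    rw [← mul_assoc, ← (Set.mem_center_iff.mp hc).comm] at this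
    simpa [mul_assoc] using this
  exact this hz

lemma smul_mem_center (c : ℂ) {z : B} (hz : z ∈ Set.center B) : c • z ∈ Set.center B :=
  (Subalgebra.center ℂ B).smul_mem hz c

lemma smul_mem_dixmierSet (c : ℂ) {a z : B} (hz : z ∈ dixmierSet a) :
    c • z ∈ dixmierSet (c • a) := by
  simpa using mul_mem_dixmierSet (smul_mem_center c Set.one_mem_center) hz

lemma continuous_starAlgHom {B' : Type*} [CStarAlgebra B'] (π : B →⋆ₐ[ℂ] B') : Continuous π :=
  AddMonoidHomClass.continuous_of_bound π 1 fun x => by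
    rw [one_mul]
    exact NonUnitalStarAlgHom.norm_apply_le π x

lemma map_mem_dixmierSet {B' : Type*} [CStarAlgebra B'] (π : B →⋆ₐ[ℂ] B') {a z : B}
    (hz : z ∈ dixmierSet a) : π z ∈ dixmierSet (π a) := by
  have : dixmierSet a ⊆ (π.toAlgHom.toLinearMap.restrictScalars ℝ) ⁻¹' dixmierSet (π a) := by
    refine dixmierSet_subset ((isClosed_dixmierSet _).preimage (continuous_starAlgHom π))
      ((convex_dixmierSet _).linear_preimage _) fun u => ?_
    change π ((u : B) * a * star (u : B)) ∈ dixmierSet (π a)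
    rw [map_mul, map_mul, map_star]
    exact unitary_conj_mem_dixmierSet_self (π a) ⟨π u, Unitary.map_mem π u.2⟩
  exact this hz

lemma map_mem_center {B' : Type*} [CStarAlgebra B'] (π : B →⋆ₐ[ℂ] B')
    (hπ : Function.Surjective π) {z : B} (hz : z ∈ Set.center B) : π z ∈ Set.center B' := by
  rw [Semigroup.mem_center_iff] at hz ⊢
  intro y
  obtain ⟨x, rfl⟩ := hπ y
  rw [← map_mul, hz, map_mul]

/-- An element of the Dixmier set of `a` is approximated by an averaging operator applied to `a`,
and that averaging operator can be applied to any other element. -/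
lemma exists_average {a z : B} (hz : z ∈ dixmierSet a) {ε : ℝ} (hε : 0 < ε) :
    ∃ φ : B →ₗ[ℝ] B, (∀ b, φ b ∈ dixmierSet b) ∧ ‖φ a - z‖ < ε := by
  have key : ∀ b : B, (fun φ : B →ₗ[ℝ] B => φ b) '' convexHull ℝ (Set.range unitaryConj) =
      convexHull ℝ {x : B | ∃ u : unitary B, x = (u : B) * b * star (u : B)} := fun b => by
    have h := (LinearMap.applyₗ (R := ℝ) (M := B) (M₂ := B) b).image_convexHull
      (Set.range unitaryConj)
    have hset : (LinearMap.applyₗ (R := ℝ) (M := B) (M₂ := B) b) '' Set.range unitaryConj =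
        {x : B | ∃ u : unitary B, x = (u : B) * b * star (u : B)} :=
      Set.ext fun x => by simp [eq_comm]
    rw [hset] at h
    exact h
  obtain ⟨y, hy, hyz⟩ := Metric.mem_closure_iff.mp hz ε hε
  rw [← key a] at hy
  obtain ⟨φ, hφ, rfl⟩ := hy
  refine ⟨φ, fun b => subset_closure (key b ▸ Set.mem_image_of_mem _ hφ), ?_⟩
  rwa [dist_comm, dist_eq_norm] at hyz

end DixmierSet

section Quotient

variable {B : Type*} [CStarAlgebra B]

/-- The differences of central elements lying in a common Dixmier set. -/
def centralDixmierDifferences (B : Type*) [CStarAlgebra B] : Set B :=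
  {x | ∃ a, ∃ z ∈ dixmierSet a ∩ Set.center B, ∃ w ∈ dixmierSet a ∩ Set.center B, x = z - w}

/-- The smallest closed two-sided ideal containing all differences of central elements lying in a
common Dixmier set. -/
def dixmierIdeal (B : Type*) [CStarAlgebra B] : Submodule ℂ B :=
  sInf {I | IsClosedTwoSidedIdeal I ∧ centralDixmierDifferences B ⊆ I}

lemma isClosedTwoSidedIdeal_dixmierIdeal : IsClosedTwoSidedIdeal (dixmierIdeal B) := by
  refine ⟨?_, fun a b hb => ?_⟩
  · rw [dixmierIdeal, Submodule.coe_sInf]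
    exact isClosed_biInter fun I hI => hI.1.1
  · simp only [dixmierIdeal, Submodule.mem_sInf] at hb ⊢
    exact ⟨fun I hI => (hI.1.2 a b (hb I hI)).1, fun I hI => (hI.1.2 a b (hb I hI)).2⟩

lemma centralDixmierDifferences_subset_dixmierIdeal :
    centralDixmierDifferences B ⊆ dixmierIdeal B := fun x hx => by
  simp only [dixmierIdeal, SetLike.mem_coe, Submodule.mem_sInf]
  exact fun I hI => hI.2 hx

lemma dixmierIdeal_le {I : Submodule ℂ B} (hI : IsClosedTwoSidedIdeal I)
    (h : centralDixmierDifferences B ⊆ I) : dixmierIdeal B ≤ I :=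
  sInf_le ⟨hI, h⟩

lemma IsTracialState.eq_of_mem_dixmierSet {τ : B →L[ℂ] ℂ} (hτ : IsTracialState τ) {a z : B}
    (hz : z ∈ dixmierSet a) : τ z = τ a := by
  have : dixmierSet a ⊆ (τ.toLinearMap.restrictScalars ℝ) ⁻¹' {τ a} := by
    refine dixmierSet_subset (isClosed_singleton.preimage τ.continuous)
      ((convex_singleton _).linear_preimage _) fun u => ?_
    change τ ((u : B) * a * star (u : B)) = τ a
    rw [hτ.2.2, ← mul_assoc, Unitary.star_mul_self_of_mem u.2, one_mul]
  exact this hz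

lemma dixmierIdeal_ne_top (hDP : DixmierProperty B) {τ : B →L[ℂ] ℂ} (hτ : IsTracialState τ) :
    dixmierIdeal B ≠ ⊤ := by
  let I : Submodule ℂ B := ⨅ b : B, LinearMap.ker (τ.toLinearMap ∘ₗ LinearMap.mulLeft ℂ b)
  have hmem : ∀ x, x ∈ I ↔ ∀ b, τ (b * x) = 0 := fun x => by simp [I]
  have hI : IsClosedTwoSidedIdeal I := by
    refine ⟨?_, fun a x hx => ⟨?_, ?_⟩⟩
    · have : (I : Set B) = ⋂ b : B, {x | τ (b * x) = 0} := by
        refine Set.ext fun x => ?_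
        simp [hmem]
      rw [this]
      exact isClosed_iInter fun b => isClosed_eq (by fun_prop) continuous_const
    · rw [hmem] at hx ⊢
      intro b
      rw [← mul_assoc]
      exact hx _
    · rw [hmem] at hx ⊢
      intro b
      rw [← mul_assoc, hτ.2.2, ← mul_assoc]
      exact hx _
  have hsub : centralDixmierDifferences B ⊆ I := by
    rintro _ ⟨a, z, hz, w, hw, rfl⟩
    refine (hmem _).mpr fun b => ?_
    obtain ⟨v, hv⟩ := hDP b
    have hc : z - w ∈ Set.center B := (Subalgebra.center ℂ B).sub_mem hz.2 hw.2
    have h1 : τ (b * (z - w)) = τ (v * (z - w)) := by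
      rw [hτ.2.2 b, hτ.2.2 v]
      exact (hτ.eq_of_mem_dixmierSet (mul_mem_dixmierSet hc hv.1)).symm
    rw [h1, mul_sub, map_sub, hτ.eq_of_mem_dixmierSet (mul_mem_dixmierSet hv.2 hz.1),
      hτ.eq_of_mem_dixmierSet (mul_mem_dixmierSet hv.2 hw.1), sub_self]
  intro htop
  have hIt : I = ⊤ := top_le_iff.mp (htop ▸ dixmierIdeal_le hI hsub)
  have h0 : τ = 0 := by
    refine ContinuousLinearMap.ext fun x => ?_
    have h1 : (1 : B) ∈ I := hIt ▸ Submodule.mem_top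
    simpa using (hmem 1).mp h1 x
  have := hτ.1
  simp [h0] at this

variable {C : Type*} [CStarAlgebra C]

lemma isClosedTwoSidedIdeal_ker (π : B →⋆ₐ[ℂ] C) :
    IsClosedTwoSidedIdeal (LinearMap.ker π.toAlgHom.toLinearMap) := by
  refine ⟨?_, fun a x hx => ?_⟩
  · have : Continuous π := continuous_starAlgHom π
    exact isClosed_singleton.preimage this
  · have hx' : π x = 0 := hx
    constructor
    · change π (a * x) = 0
      rw [map_mul, hx', mul_zero]
    · change π (x * a) = 0
      rw [map_mul, hx', zero_mul]

lemma SingletonDixmierProperty.map_eq_zero_of_mem_dixmierIdeal (π : B →⋆ₐ[ℂ] C)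
    (hπ : Function.Surjective π) (hC : SingletonDixmierProperty C) {x : B}
    (hx : x ∈ dixmierIdeal B) : π x = 0 := by
  have hsub : centralDixmierDifferences B ⊆ LinearMap.ker π.toAlgHom.toLinearMap := by
    rintro _ ⟨a, z, hz, w, hw, rfl⟩
    obtain ⟨c, hc⟩ := hC (π a)
    have h : ∀ v ∈ dixmierSet a ∩ Set.center B, π v = c := fun v hv =>
      hc.subset ⟨map_mem_dixmierSet π hv.1, map_mem_center π hπ hv.2⟩
    change π (z - w) = 0
    rw [map_sub, h z hz, h w hw, sub_self]
  exact dixmierIdeal_le (isClosedTwoSidedIdeal_ker π) hsub hx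

/-- If all central elements in a Dixmier set have the same image under `π`, then that image is
given by a contractive trace-like map which sends `a` to the image of the central elements of
the Dixmier set of `a`. -/
lemma exists_central_trace (hDP : DixmierProperty B) (π : B →⋆ₐ[ℂ] C)
    (h : ∀ x ∈ centralDixmierDifferences B, π x = 0) :
    ∃ E : B →L[ℂ] C, (∀ a, ∀ z ∈ dixmierSet a ∩ Set.center B, E a = π z) ∧
      ∀ a b, E (a * b) = E (b * a) := by
  choose e he using hDP
  have heq : ∀ a, ∀ z ∈ dixmierSet a ∩ Set.center B, π (e a) = π z := fun a z hz => by
    have := h _ ⟨a, e a, he a, z, hz, rfl⟩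
    rwa [map_sub, sub_eq_zero] at this
  have hsmul : ∀ (c : ℂ) a, π (e (c • a)) = c • π (e a) := fun c a => by
    rw [heq _ (c • e a) ⟨smul_mem_dixmierSet c (he a).1, smul_mem_center c (he a).2⟩, map_smul]
  have hadd : ∀ a b, π (e (a + b)) = π (e a) + π (e b) := fun a b => by
    rw [← sub_eq_zero, ← norm_le_zero_iff]
    refine le_of_forall_pos_le_add fun ε hε => ?_
    obtain ⟨φ, hφ, hφa⟩ := exists_average (he a).1 (half_pos hε)
    obtain ⟨ψ, hψ, hψb⟩ := exists_average (he (φ b)).1 (half_pos hε)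
    have hψa : ‖ψ (φ a) - e a‖ ≤ ε / 2 := by
      rw [← mem_closedBall_iff_norm]
      exact dixmierSet_subset_closedBall (he a).2 hφa.le (hψ _)
    have hmem : ∀ x, dixmierSet (ψ (φ x)) ⊆ dixmierSet x := fun x =>
      (dixmierSet_subset_of_mem (hψ _)).trans (dixmierSet_subset_of_mem (hφ _))
    have hw := he (ψ (φ (a + b)))
    have hz := he (φ b)
    have hc : e a + e (φ b) ∈ Set.center B := (Subalgebra.center ℂ B).add_mem (he a).2 hz.2
    have hnorm : ‖ψ (φ (a + b)) - (e a + e (φ b))‖ ≤ ε := by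
      rw [map_add, map_add, add_sub_add_comm]
      exact (norm_add_le _ _).trans (by linarith)
    have hd := dixmierSet_subset_closedBall hc hnorm hw.1
    rw [mem_closedBall_iff_norm] at hd
    rw [heq _ _ ⟨hmem _ hw.1, hw.2⟩, heq b _ ⟨dixmierSet_subset_of_mem (hφ b) hz.1, hz.2⟩,
      ← map_add, ← map_sub, zero_add]
    exact (NonUnitalStarAlgHom.norm_apply_le π _).trans hd
  have hbound : ∀ a, ‖π (e a)‖ ≤ 1 * ‖a‖ := fun a => by
    have := dixmierSet_subset_closedBall (a := a) (r := ‖a‖) Set.zero_mem_center (by simp) (he a).1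
    rw [mem_closedBall_zero_iff] at this
    rw [one_mul]
    exact (NonUnitalStarAlgHom.norm_apply_le π _).trans this
  let E : B →L[ℂ] C := LinearMap.mkContinuous
    { toFun := fun a => π (e a), map_add' := hadd, map_smul' := hsmul } 1 hbound
  have hE : ∀ a, E a = π (e a) := fun _ => rfl
  refine ⟨E, heq, fun a b => ?_⟩
  have hunit : ∀ u : unitary B, E ((u : B) * b) = E (b * u) := fun u => by
    have := dixmierSet_unitary_conj_subset (b * u) u
    have h1 : (u : B) * (b * u) * star (u : B) = u * b := by
      rw [mul_assoc, mul_assoc, Unitary.mul_star_self_of_mem u.2, mul_one]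
    rw [h1] at this
    rw [hE, hE]
    exact (heq _ _ ⟨this (he _).1, (he _).2⟩).symm
  have ha : a ∈ Submodule.span ℂ (unitary B : Set B) := by
    rw [CStarAlgebra.span_unitary]; trivial
  induction ha using Submodule.span_induction with
  | mem x hx => exact hunit ⟨x, hx⟩
  | zero => simp
  | add x y _ _ hx hy => simp only [add_mul, mul_add, map_add, hx, hy]
  | smul c x _ hx => simp only [smul_mul_assoc, mul_smul_comm, map_smul, hx]

lemma singletonDixmierProperty_of_map_eq_zero (hDP : DixmierProperty B) (π : B →⋆ₐ[ℂ] C)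
    (hπ : Function.Surjective π) (h : ∀ x ∈ centralDixmierDifferences B, π x = 0) :
    SingletonDixmierProperty C := by
  obtain ⟨E, hE, htr⟩ := exists_central_trace hDP π h
  have hker : ∀ x y, π x = π y → E x = E y := fun x y hxy => by
    rw [← sub_eq_zero, ← map_sub]
    obtain ⟨z, hz⟩ := hDP (x - y)
    have h0 := map_mem_dixmierSet π hz.1
    rw [map_sub, hxy, sub_self, dixmierSet_of_mem_center Set.zero_mem_center] at h0
    rw [hE _ z hz]
    exact h0
  intro c
  obtain ⟨a, rfl⟩ := hπ c
  refine ⟨E a, Set.Subset.antisymm ?_ ?_⟩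
  · rintro w ⟨hw, hwc⟩
    let S : Set C := {y | ∀ x, π x = y → E x = E a}
    have hS : ∀ x, π x ∈ S ↔ E x = E a := fun x =>
      ⟨fun hx => hx x rfl, fun hx y hy => (hker y x hy).trans hx⟩
    have hSclosed : IsClosed S := by
      let πL : B →L[ℂ] C := ⟨π.toAlgHom.toLinearMap, continuous_starAlgHom π⟩
      have hq := πL.isQuotientMap hπ
      rw [← hq.isClosed_preimage]
      have : πL ⁻¹' S = {x | E x = E a} := Set.ext hS
      rw [this]
      exact isClosed_eq E.continuous continuous_const
    have hSconv : Convex ℝ S := by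
      intro y hy y' hy' s t _ _ hst
      obtain ⟨x, rfl⟩ := hπ y
      obtain ⟨x', rfl⟩ := hπ y'
      rw [hS] at hy hy'
      have h1 : s • π x + t • π x' = π ((s : ℂ) • x + (t : ℂ) • x') := by
        rw [map_add, map_smul, map_smul, Complex.coe_smul, Complex.coe_smul]
      rw [h1, hS, map_add, map_smul, map_smul, hy, hy', ← add_smul, ← Complex.ofReal_add, hst]
      simp
    have hSu : ∀ u : unitary C, (u : C) * π a * star (u : C) ∈ S := by
      intro u
      obtain ⟨v, hv⟩ := hπ u
      rw [← hv, ← map_star, ← map_mul, ← map_mul, hS, htr, ← mul_assoc]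
      apply hker
      rw [map_mul, map_mul, map_star, hv, Unitary.star_mul_self_of_mem u.2, one_mul]
    have hwS := dixmierSet_subset hSclosed hSconv hSu hw
    obtain ⟨x, rfl⟩ := hπ w
    obtain ⟨z, hz⟩ := hDP x
    have hxz := map_mem_dixmierSet π hz.1
    rw [dixmierSet_of_mem_center hwc] at hxz
    have hxz' : π z = π x := hxz
    rw [Set.mem_singleton_iff, ← (hS x).mp hwS, hE x z hz, hxz']
  · obtain ⟨z, hz⟩ := hDP a
    rintro _ rfl
    rw [hE a z hz]
    exact ⟨map_mem_dixmierSet π hz.1, map_mem_center π hπ hz.2⟩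

end Quotient

section QuotientCStarAlgebra

variable {B : Type*} [CStarAlgebra B]

/-- Elements of a two-sided ideal are approximately annihilated by self-adjoint contractions which
are congruent to `1` modulo the ideal. -/
lemma exists_isSelfAdjoint_norm_mul_le (I : Ideal B) [I.IsTwoSided] {j : B} (hj : j ∈ I) {ε : ℝ}
    (hε : 0 < ε) : ∃ g : B, IsSelfAdjoint g ∧ ‖g‖ ≤ 1 ∧ 1 - g ∈ I ∧ ‖j * g‖ ≤ ε := by
  have hpos : ∀ x ∈ spectrum ℝ (star j * j), 0 ≤ x := spectrum_star_mul_self_nonneg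
  have hε2 : 0 < ε ^ 2 := by positivity
  have hden : ∀ x ∈ spectrum ℝ (star j * j), ε ^ 2 + x ≠ 0 := fun x hx =>
    (add_pos_of_pos_of_nonneg hε2 (hpos x hx)).ne'
  have hcont : ContinuousOn (fun x : ℝ => ε ^ 2 / (ε ^ 2 + x)) (spectrum ℝ (star j * j)) :=
    ContinuousOn.div (by fun_prop) (by fun_prop) hden
  have hcont' : ContinuousOn (fun x : ℝ => 1 / (ε ^ 2 + x)) (spectrum ℝ (star j * j)) :=
    ContinuousOn.div (by fun_prop) (by fun_prop) hden
  have hsa : IsSelfAdjoint (cfc (fun x : ℝ => ε ^ 2 / (ε ^ 2 + x)) (star j * j)) :=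
    cfc_predicate _ _
  refine ⟨_, hsa, ?_, ?_, ?_⟩
  · refine norm_cfc_le zero_le_one fun x hx => ?_
    have := hpos x hx
    rw [Real.norm_of_nonneg (by positivity)]
    exact (div_le_one (by positivity)).mpr (by linarith)
  · have h1 : (1 : B) - cfc (fun x : ℝ => ε ^ 2 / (ε ^ 2 + x)) (star j * j) =
        cfc (fun x : ℝ => 1 / (ε ^ 2 + x)) (star j * j) * (star j * j) := by
      have hmul := cfc_mul _ (fun x : ℝ => x) (star j * j) hcont' (by fun_prop)
      have hsub := cfc_sub (fun _ : ℝ => (1 : ℝ)) _ (star j * j) (by fun_prop) hcont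
      rw [cfc_id' ℝ (star j * j)] at hmul
      rw [cfc_const_one ℝ (star j * j)] at hsub
      rw [← hmul, ← hsub]
      refine cfc_congr fun x hx => ?_
      have := hden x hx
      field_simp
      ring
    rw [h1]
    exact I.mul_mem_left _ (I.mul_mem_left _ hj)
  · refine abs_le_of_sq_le_sq' ?_ hε.le |>.2
    rw [sq, ← CStarRing.norm_star_mul_self, star_mul, hsa.star_eq, mul_assoc, ← mul_assoc (star j)]
    have h2 : cfc (fun x : ℝ => ε ^ 2 / (ε ^ 2 + x)) (star j * j) *
        ((star j * j) * cfc (fun x : ℝ => ε ^ 2 / (ε ^ 2 + x)) (star j * j)) =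
        cfc (fun x : ℝ => ε ^ 2 / (ε ^ 2 + x) * (x * (ε ^ 2 / (ε ^ 2 + x)))) (star j * j) := by
      rw [cfc_mul _ (fun x : ℝ => x * (ε ^ 2 / (ε ^ 2 + x))) _ hcont
          (ContinuousOn.mul (by fun_prop) hcont), cfc_mul (fun x => x) _ _ (by fun_prop) hcont,
        cfc_id' ℝ (star j * j)]
    rw [h2]
    refine norm_cfc_le hε2.le fun x hx => ?_
    have := hpos x hx
    rw [Real.norm_of_nonneg (by positivity), div_mul_eq_mul_div, div_le_iff₀ (by positivity)]
    refine mul_le_mul_of_nonneg_left ?_ hε2.le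
    rw [← mul_div_assoc, div_le_iff₀ (by positivity)]
    nlinarith [mul_nonneg this this, mul_nonneg this hε2.le, mul_pos hε2 hε2]

lemma star_mem_of_isClosed (I : Ideal B) [I.IsTwoSided] (hI : IsClosed (I : Set B)) {j : B}
    (hj : j ∈ I) : star j ∈ I := by
  rw [← SetLike.mem_coe, ← hI.closure_eq, Metric.mem_closure_iff]
  intro ε hε
  obtain ⟨g, hg, -, hgI, hjg⟩ := exists_isSelfAdjoint_norm_mul_le I hj (half_pos hε)
  refine ⟨(1 - g) * star j, I.mul_mem_right _ hgI, ?_⟩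
  have : star j - (1 - g) * star j = star (j * g) := by
    rw [star_mul, hg.star_eq]
    noncomm_ring
  rw [dist_eq_norm, this, norm_star]
  linarith

lemma norm_mk_sq_le (I : Ideal B) [I.IsTwoSided] (a : B) {j : B} (hj : j ∈ I) :
    ‖Ideal.Quotient.mk I a‖ * ‖Ideal.Quotient.mk I a‖ ≤ ‖star a * a + j‖ := by
  refine le_of_forall_pos_le_add fun ε hε => ?_
  obtain ⟨g, hg, hg1, hgI, hjg⟩ := exists_isSelfAdjoint_norm_mul_le I hj hε
  have h1 : Ideal.Quotient.mk I a = Ideal.Quotient.mk I (a * g) := by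
    rw [Ideal.Quotient.eq]
    have : a - a * g = a * (1 - g) := by noncomm_ring
    rw [this]
    exact I.mul_mem_left _ hgI
  have h2 : ‖Ideal.Quotient.mk I a‖ ≤ ‖a * g‖ := by
    rw [h1]
    exact Submodule.Quotient.norm_mk_le I (a * g)
  have h3 : star (a * g) * (a * g) = g * ((star a * a + j) * g) - g * (j * g) := by
    rw [star_mul, hg.star_eq]
    noncomm_ring
  calc _ ≤ ‖a * g‖ * ‖a * g‖ := mul_self_le_mul_self (norm_nonneg _) h2
    _ = ‖g * ((star a * a + j) * g) - g * (j * g)‖ := by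
      rw [← CStarRing.norm_star_mul_self, h3]
    _ ≤ ‖g * ((star a * a + j) * g)‖ + ‖g * (j * g)‖ := norm_sub_le _ _
    _ ≤ ‖star a * a + j‖ + ε := by
      refine add_le_add ((norm_mul_le _ _).trans ?_) ((norm_mul_le _ _).trans ?_)
      · refine (mul_le_of_le_one_left (norm_nonneg _) hg1).trans ((norm_mul_le _ _).trans ?_)
        exact mul_le_of_le_one_right (norm_nonneg _) hg1
      · exact (mul_le_of_le_one_left (norm_nonneg _) hg1).trans hjg

lemma norm_quotient_mul_le (I : Ideal B) [I.IsTwoSided] (x y : B ⧸ I) :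
    ‖x * y‖ ≤ ‖x‖ * ‖y‖ := by
  have key : ∀ δ : ℝ, 0 < δ → ‖x * y‖ ≤ (‖x‖ + δ) * (‖y‖ + δ) := fun δ hδ => by
    obtain ⟨a, rfl, ha⟩ := Submodule.Quotient.norm_mk_lt x hδ
    obtain ⟨b, rfl, hb⟩ := Submodule.Quotient.norm_mk_lt y hδ
    exact (Submodule.Quotient.norm_mk_le I (a * b)).trans <| (norm_mul_le _ _).trans <|
      mul_le_mul ha.le hb.le (norm_nonneg _) (by positivity)
  have hlim : Filter.Tendsto (fun δ : ℝ => (‖x‖ + δ) * (‖y‖ + δ)) (nhdsWithin 0 (Set.Ioi 0))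
      (nhds (‖x‖ * ‖y‖)) := by
    have : Continuous fun δ : ℝ => (‖x‖ + δ) * (‖y‖ + δ) := by fun_prop
    simpa using (this.tendsto 0).mono_left nhdsWithin_le_nhds
  exact ge_of_tendsto hlim (Filter.eventually_of_mem self_mem_nhdsWithin key)

/-- The quotient of a unital C*-algebra by a closed two-sided ideal is a C*-algebra. -/
abbrev quotientCStarAlgebra (I : Ideal B) [I.IsTwoSided] (hI : IsClosed (I : Set B)) :
    CStarAlgebra (B ⧸ I) :=
  letI := hI
  { Submodule.Quotient.normedAddCommGroup I, Ideal.Quotient.ring I,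
    Submodule.Quotient.normedSpace I ℂ, Ideal.Quotient.algebra ℂ,
    Submodule.Quotient.completeSpace I with
    dist_eq := dist_eq_norm_neg_add
    norm_mul_le := norm_quotient_mul_le I
    star := Quotient.map' star fun a b hab => by
      rw [Submodule.quotientRel_def] at hab ⊢
      rw [← star_sub]
      exact star_mem_of_isClosed I hI hab
    star_involutive := by
      rintro ⟨a⟩
      exact congrArg (Ideal.Quotient.mk I) (star_star a)
    star_mul := by
      rintro ⟨a⟩ ⟨b⟩
      exact congrArg (Ideal.Quotient.mk I) (star_mul a b)
    star_add := by
      rintro ⟨a⟩ ⟨b⟩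
      exact congrArg (Ideal.Quotient.mk I) (star_add a b)
    star_smul := by
      rintro c ⟨a⟩
      exact congrArg (Ideal.Quotient.mk I) (star_smul c a)
    norm_mul_self_le := by
      rintro ⟨a⟩
      refine le_of_forall_pos_le_add fun ε hε => ?_
      obtain ⟨b, hb, hbε⟩ := Submodule.Quotient.norm_mk_lt (Ideal.Quotient.mk I (star a * a)) hε
      have hbI : b - star a * a ∈ I := Ideal.Quotient.eq.mp hb
      have := norm_mk_sq_le I a hbI
      rw [add_sub_cancel] at this
      exact this.trans hbε.le }

lemma exists_surjective_starAlgHom_of_isClosedTwoSidedIdeal {B : Type u} [CStarAlgebra B]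
    {J : Submodule ℂ B} (hJ : IsClosedTwoSidedIdeal J) (hJtop : J ≠ ⊤) :
    ∃ (C : Type u) (_ : CStarAlgebra C) (π : B →⋆ₐ[ℂ] C), Function.Surjective π ∧ Nontrivial C ∧
      ∀ x, π x = 0 ↔ x ∈ J := by
  let I : Ideal B :=
    { carrier := J
      add_mem' := J.add_mem
      zero_mem' := J.zero_mem
      smul_mem' := fun a b hb => (hJ.2 a b hb).1 }
  have : I.IsTwoSided := ⟨fun b ha => (hJ.2 b _ ha).2⟩
  have hI : IsClosed (I : Set B) := hJ.1
  have hItop : I ≠ ⊤ := fun h => hJtop <| Submodule.eq_top_iff'.mpr fun x =>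
    (h ▸ Submodule.mem_top : x ∈ I)
  let := quotientCStarAlgebra I hI
  refine ⟨B ⧸ I, this, { Ideal.Quotient.mkₐ ℂ I with map_star' := fun a => rfl },
    Ideal.Quotient.mk_surjective, Ideal.Quotient.nontrivial_iff.mpr hItop,
    fun x => Ideal.Quotient.eq_zero_iff_mem⟩

end QuotientCStarAlgebra

/-- **Corollary 2.8.**  If `A` is a unital C*-algebra with the Dixmier property and `T(A) ≠ ∅`,
then there is a unique proper closed two-sided ideal `J` of `A` such that for every proper
closed two-sided ideal `K`, the quotient `A/K` has the singleton Dixmier property iff `K ⊇ J`.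
Quotients `A/K` are represented by surjective star-algebra homomorphisms `π : A → B` onto
nonzero C*-algebras (`K = ker π`, and `K ⊇ J` reads `π` vanishes on `J`). -/
theorem exists_unique_ideal_for_singletonDixmier_quotients
    (A : Type u) [CStarAlgebra A] (hDP : DixmierProperty A)
    (hT : ∃ τ : A →L[ℂ] ℂ, IsTracialState τ) :
    ∃! J : Submodule ℂ A, (IsClosedTwoSidedIdeal J ∧ J ≠ ⊤) ∧
      ∀ (B : Type u) [CStarAlgebra B], ∀ π : A →⋆ₐ[ℂ] B, Function.Surjective π →
        Nontrivial B → (SingletonDixmierProperty B ↔ ∀ x ∈ J, π x = 0) := by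
  have forward : ∀ (B : Type u) [CStarAlgebra B], ∀ π : A →⋆ₐ[ℂ] B, Function.Surjective π →
      Nontrivial B → (SingletonDixmierProperty B ↔ ∀ x ∈ dixmierIdeal A, π x = 0) :=
    fun B _ π hπ _ => ⟨fun hB x hx => hB.map_eq_zero_of_mem_dixmierIdeal π hπ hx, fun h =>
      singletonDixmierProperty_of_map_eq_zero hDP π hπ fun x hx =>
        h x (centralDixmierDifferences_subset_dixmierIdeal hx)⟩
  have htop : dixmierIdeal A ≠ ⊤ := hT.elim fun τ hτ => dixmierIdeal_ne_top hDP hτ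
  refine ⟨dixmierIdeal A, ⟨⟨isClosedTwoSidedIdeal_dixmierIdeal, htop⟩, forward⟩, ?_⟩
  rintro J ⟨⟨hJ, hJtop⟩, h⟩
  apply le_antisymm
  · obtain ⟨B, _, π, hπ, hB, hker⟩ := exists_surjective_starAlgHom_of_isClosedTwoSidedIdeal
      (isClosedTwoSidedIdeal_dixmierIdeal (B := A)) htop
    have hSDP := (forward B π hπ hB).mpr fun x hx => (hker x).mpr hx
    exact fun x hx => (hker x).mp ((h B π hπ hB).mp hSDP x hx)
  · obtain ⟨B, _, π, hπ, hB, hker⟩ := exists_surjective_starAlgHom_of_isClosedTwoSidedIdeal hJ hJtop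
    have hSDP := (h B π hπ hB).mpr fun x hx => (hker x).mpr hx
    exact fun x hx => (hker x).mp ((forward B π hπ hB).mp hSDP x hx)

end
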